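/- arXiv:2303.15733 — 10 statements merged into one kernel-verified Lean document; each statement's English description precedes it below -/
import Mathlib

section
/- Let M be a real symmetric 3×3 matrix such that G := tr(M)·I − M is positive definite. Then the modified trace function Ψ_M satisfies Ψ_M(X) ≥ 0 for every X ∈ SO(3), and Ψ_M(X) = 0 if and only if X = I. (That is, Ψ_M is a potential function on SO(3) relative to {I}.) -/
open Matrix Real

noncomputable section

/-- The special orthogonal group SO(3) as a set of real 3×3 matrices. -/
def SO3 : Set (Matrix (Fin 3) (Fin 3) ℝ) := {R | Rᵀ * R = 1 ∧ R.det = 1}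

/-- The modified trace function Ψ_M(X) = tr(M(I − X)). -/
def psiM (M X : Matrix (Fin 3) (Fin 3) ℝ) : ℝ := (M * (1 - X)).trace

/-- The Cayley-Hamilton identity on SO(3), with the inverse written as the transpose. -/
lemma mul_self_of_mem_SO3 {X : Matrix (Fin 3) (Fin 3) ℝ} (hX : X ∈ SO3) :
    X * X = X.trace • X - X.trace • (1 : Matrix (Fin 3) (Fin 3) ℝ) + Xᵀ := by
  obtain ⟨hO, hdet⟩ := hX
  have hadj : Xᵀ = X.adjugate := by
    calc Xᵀ = Xᵀ * (X * X.adjugate) := by rw [mul_adjugate, hdet, one_smul, mul_one]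
      _ = X.adjugate := by rw [← mul_assoc, hO, one_mul]
  have hcof (i j : Fin 3) : X j i = X.adjugate i j := by rw [← hadj, transpose_apply]
  simp only [adjugate_fin_three] at hcof
  have h00 := hcof 0 0
  have h01 := hcof 0 1
  have h02 := hcof 0 2
  have h10 := hcof 1 0
  have h11 := hcof 1 1
  have h12 := hcof 1 2
  have h20 := hcof 2 0
  have h21 := hcof 2 1
  have h22 := hcof 2 2
  simp at h00 h01 h02 h10 h11 h12 h20 h21 h22
  ext i j
  fin_cases i <;> fin_cases j <;>
    simp [Matrix.mul_apply, Fin.sum_univ_three, Matrix.trace_fin_three] <;>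
    linarith

/-- Twice the symmetric part of `X`, shifted by `(1 - tr X) • 1`. For a rotation by `θ` about the
unit vector `u` this is `2 (1 - cos θ) u uᵀ`. -/
def axisMatrix (X : Matrix (Fin 3) (Fin 3) ℝ) : Matrix (Fin 3) (Fin 3) ℝ :=
  X + Xᵀ + (1 - X.trace) • (1 : Matrix (Fin 3) (Fin 3) ℝ)

lemma axisMatrix_transpose (X : Matrix (Fin 3) (Fin 3) ℝ) :
    (axisMatrix X)ᵀ = axisMatrix X := by
  simp [axisMatrix, add_comm]

lemma trace_axisMatrix (X : Matrix (Fin 3) (Fin 3) ℝ) :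
    (axisMatrix X).trace = 3 - X.trace := by
  simp [axisMatrix]
  ring

lemma axisMatrix_mul_self {X : Matrix (Fin 3) (Fin 3) ℝ} (hX : X ∈ SO3) :
    axisMatrix X * axisMatrix X = (3 - X.trace) • axisMatrix X := by
  have hsq := mul_self_of_mem_SO3 hX
  have hsqT : Xᵀ * Xᵀ = X.trace • Xᵀ - X.trace • (1 : Matrix (Fin 3) (Fin 3) ℝ) + X := by
    simpa using congrArg transpose hsq
  have hO' : X * Xᵀ = 1 := mul_eq_one_comm.mp hX.1
  simp only [axisMatrix, add_mul, mul_add, smul_mul_assoc, mul_smul_comm, one_mul, mul_one,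
    hsq, hsqT, hO', hX.1]
  module

lemma trace_mul_axisMatrix {M : Matrix (Fin 3) (Fin 3) ℝ} (hM : M.IsSymm)
    (X : Matrix (Fin 3) (Fin 3) ℝ) :
    ((M.trace • (1 : Matrix (Fin 3) (Fin 3) ℝ) - M) * axisMatrix X).trace = 2 * psiM M X := by
  have hT : (M * Xᵀ).trace = (M * X).trace := by
    rw [← trace_transpose, transpose_mul, transpose_transpose, hM.eq, trace_mul_comm]
  simp [axisMatrix, psiM, sub_mul, mul_add, mul_sub, hT]
  ring

lemma apply_le_one_of_transpose_mul_self {n : Type*} [Fintype n] [DecidableEq n]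
    {X : Matrix n n ℝ} (hX : Xᵀ * X = 1) (i : n) : X i i ≤ 1 := by
  have h : ∑ k, X k i * X k i = 1 := by
    simpa [Matrix.mul_apply] using congrFun (congrFun hX i) i
  have hi : X i i * X i i ≤ ∑ k, X k i * X k i :=
    Finset.single_le_sum (f := fun k => X k i * X k i)
      (fun k _ => mul_self_nonneg _) (Finset.mem_univ i)
  nlinarith

lemma trace_le_three_of_mem_SO3 {X : Matrix (Fin 3) (Fin 3) ℝ} (hX : X ∈ SO3) :
    X.trace ≤ 3 := by
  have h := apply_le_one_of_transpose_mul_self hX.1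
  rw [trace_fin_three]
  linarith [h 0, h 1, h 2]

/-- The squared Frobenius distance from an orthogonal `X` to `1` is `2 (3 - tr X)`. -/
lemma eq_one_of_trace_eq_three {X : Matrix (Fin 3) (Fin 3) ℝ} (hX : X ∈ SO3)
    (ht : X.trace = 3) : X = 1 := by
  have h : ((X - 1)ᴴ * (X - 1)).trace = 0 := by
    simp [conjTranspose_eq_transpose_of_trivial, sub_mul, mul_sub, hX.1, ht]
  exact sub_eq_zero.mp (trace_conjTranspose_mul_self_eq_zero_iff.mp h)

lemma Matrix.PosDef.eq_zero_of_conjTranspose_mul_mul_eq_zero {m n : Type*} [Fintype m]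
    [DecidableEq m] [Fintype n] {A : Matrix n n ℝ} (hA : A.PosDef) {B : Matrix n m ℝ}
    (h : Bᴴ * A * B = 0) : B = 0 := by
  refine ext_of_mulVec_single fun j => ?_
  rw [zero_mulVec]
  by_contra hne
  have hpos := hA.dotProduct_mulVec_pos hne
  simp only [star_mulVec, dotProduct_mulVec, vecMul_vecMul, h, vecMul_zero, zero_dotProduct,
    lt_irrefl] at hpos

lemma psiM_pos_of_trace_lt_three {M X : Matrix (Fin 3) (Fin 3) ℝ} (hM : M.IsSymm)
    (hG : (M.trace • (1 : Matrix (Fin 3) (Fin 3) ℝ) - M).PosDef) (hX : X ∈ SO3)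
    (ht : X.trace < 3) : 0 < psiM M X := by
  set G := M.trace • (1 : Matrix (Fin 3) (Fin 3) ℝ) - M with hGdef
  have hprod : ((axisMatrix X)ᴴ * G * axisMatrix X).trace
      = (3 - X.trace) * (2 * psiM M X) := by
    rw [conjTranspose_eq_transpose_of_trivial, axisMatrix_transpose, mul_assoc, trace_mul_comm,
      mul_assoc, axisMatrix_mul_self hX, mul_smul_comm, trace_smul, hGdef,
      trace_mul_axisMatrix hM, smul_eq_mul]
  have hpsd : ((axisMatrix X)ᴴ * G * axisMatrix X).PosSemidef :=
    hG.posSemidef.conjTranspose_mul_mul_same _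
  have hne : ((axisMatrix X)ᴴ * G * axisMatrix X).trace ≠ 0 := by
    intro h0
    have hz := hpsd.trace_eq_zero_iff.mp h0
    have hB := hG.eq_zero_of_conjTranspose_mul_mul_eq_zero hz
    have := trace_axisMatrix X
    rw [hB, trace_zero] at this
    linarith
  have hpos := lt_of_le_of_ne hpsd.trace_nonneg hne.symm
  rw [hprod] at hpos
  have := pos_of_mul_pos_right hpos (by linarith)
  linarith

/-- Ψ_M is a potential function on SO(3) relative to {I} when
G := tr(M)·I − M is positive definite. -/
theorem modified_trace_is_potential_function
    (M : Matrix (Fin 3) (Fin 3) ℝ) (hM : M.IsSymm)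
    (hG : (M.trace • (1 : Matrix (Fin 3) (Fin 3) ℝ) - M).PosDef) :
    ∀ X ∈ SO3, 0 ≤ psiM M X ∧ (psiM M X = 0 ↔ X = 1) := by
  intro X hX
  rcases (trace_le_three_of_mem_SO3 hX).lt_or_eq with ht | ht
  · have hpos := psiM_pos_of_trace_lt_three hM hG hX ht
    refine ⟨hpos.le, fun h => absurd h hpos.ne', ?_⟩
    rintro rfl
    simp at ht
  · obtain rfl := eq_one_of_trace_eq_three hX ht
    simp [psiM]

end
end

section
/- Let M be a real symmetric 3×3 matrix and set G := tr(M)·I − M. Suppose G is positive semidefinite and c ∈ ℝ is such that c·I − G is positive semidefinite. Then for every X ∈ SO(3), 0 ≤ tr(M(I − X)) ≤ 2c. In particular Ψ_M(X) ≤ 2·λ_max(G) for all X ∈ SO(3). -/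
open Matrix Real

noncomputable section

/-- Cayley–Hamilton in dimension three, divided by the matrix. -/
lemma adjugate_fin_three_eq_sq (X : Matrix (Fin 3) (Fin 3) ℝ) :
    X.adjugate = X * X - X.trace • X + X.adjugate.trace • 1 := by
  ext i j
  fin_cases i <;> fin_cases j <;>
    simp [adjugate_fin_three, Matrix.mul_apply, Fin.sum_univ_three, trace_fin_three] <;> ring

lemma adjugate_eq_transpose_of_mem_SO3 {X : Matrix (Fin 3) (Fin 3) ℝ} (hX : X ∈ SO3) :
    X.adjugate = Xᵀ := by
  rw [← one_mul X.adjugate, ← hX.1, mul_assoc, mul_adjugate, hX.2, one_smul, mul_one]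

lemma sq_of_mem_SO3 {X : Matrix (Fin 3) (Fin 3) ℝ} (hX : X ∈ SO3) :
    X * X = Xᵀ + X.trace • X - X.trace • 1 := by
  have h := adjugate_fin_three_eq_sq X
  rw [adjugate_eq_transpose_of_mem_SO3 hX, trace_transpose] at h
  rw [h]
  abel

lemma trace_transpose_mul_self_nonneg (A : Matrix (Fin 3) (Fin 3) ℝ) : 0 ≤ (Aᵀ * A).trace := by
  simpa using (posSemidef_conjTranspose_mul_self A).trace_nonneg

lemma neg_one_le_trace_of_mem_SO3 {X : Matrix (Fin 3) (Fin 3) ℝ} (hX : X ∈ SO3) :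
    -1 ≤ X.trace := by
  have h := trace_transpose_mul_self_nonneg (X - Xᵀ)
  have hX' : X * Xᵀ = 1 := mul_eq_one_comm.mp hX.1
  have hT : (Xᵀ * Xᵀ).trace = (X * X).trace := by
    rw [← transpose_mul, trace_transpose]
  simp only [transpose_sub, transpose_transpose, sub_mul, mul_sub, hX.1, hX', trace_sub, hT,
    sq_of_mem_SO3 hX, trace_add, trace_smul, trace_transpose, trace_one, Fintype.card_fin,
    smul_eq_mul] at h
  norm_num at h
  nlinarith [trace_le_three_of_mem_SO3 hX]

/-- For the rotation `X` of angle `θ` about the unit vector `u`, this is `(1 - cos θ) u uᵀ`. -/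
def axisProj (X : Matrix (Fin 3) (Fin 3) ℝ) : Matrix (Fin 3) (Fin 3) ℝ :=
  ((1 - X.trace) / 2) • 1 + (1 / 2 : ℝ) • (X + Xᵀ)

lemma trace_axisProj (X : Matrix (Fin 3) (Fin 3) ℝ) :
    (axisProj X).trace = (3 - X.trace) / 2 := by
  simp [axisProj]
  ring

lemma isSymm_axisProj (X : Matrix (Fin 3) (Fin 3) ℝ) : (axisProj X)ᵀ = axisProj X := by
  simp [axisProj, add_comm]

lemma axisProj_mul_self {X : Matrix (Fin 3) (Fin 3) ℝ} (hX : X ∈ SO3) :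
    axisProj X * axisProj X = (axisProj X).trace • axisProj X := by
  have h2 : Xᵀ * Xᵀ = X + X.trace • Xᵀ - X.trace • 1 := by
    simpa using congrArg transpose (sq_of_mem_SO3 hX)
  have hX' : X * Xᵀ = 1 := mul_eq_one_comm.mp hX.1
  rw [trace_axisProj]
  simp only [axisProj, add_mul, mul_add, smul_mul_assoc, mul_smul_comm, one_mul, mul_one, hX.1,
    hX', h2, sq_of_mem_SO3 hX]
  module

lemma trace_mul_axisProj_nonneg {A X : Matrix (Fin 3) (Fin 3) ℝ} (hA : A.PosSemidef)
    (hX : X ∈ SO3) : 0 ≤ (A * axisProj X).trace := by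
  have hH : (axisProj X)ᴴ = axisProj X := by
    rw [conjTranspose_eq_transpose_of_trivial, isSymm_axisProj]
  have hsq := axisProj_mul_self hX
  have ht : 0 ≤ (axisProj X).trace := by
    rw [trace_axisProj]
    linarith [trace_le_three_of_mem_SO3 hX]
  rcases ht.eq_or_lt with h0 | hpos
  · rw [← h0, zero_smul] at hsq
    have hQ : axisProj X = 0 := conjTranspose_mul_self_eq_zero.mp (by rw [hH, hsq])
    simp [hQ]
  · have h := (hA.mul_mul_conjTranspose_same (axisProj X)).trace_nonneg
    rw [hH, trace_mul_cycle, hsq, smul_mul_assoc, trace_smul, trace_mul_comm, smul_eq_mul] at h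
    exact nonneg_of_mul_nonneg_right h hpos

lemma psiM_eq_trace_mul_axisProj {M : Matrix (Fin 3) (Fin 3) ℝ} (hM : M.IsSymm)
    (X : Matrix (Fin 3) (Fin 3) ℝ) :
    psiM M X = ((M.trace • (1 : Matrix (Fin 3) (Fin 3) ℝ) - M) * axisProj X).trace := by
  have h : (M * Xᵀ).trace = (M * X).trace := by
    rw [← trace_transpose, transpose_mul, transpose_transpose, hM.eq, trace_mul_comm]
  rw [sub_mul, trace_sub, smul_mul_assoc, one_mul, trace_smul, trace_axisProj]
  simp only [psiM, axisProj, mul_sub, mul_add, mul_smul_comm, mul_one, trace_sub, trace_add,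
    trace_smul, h, smul_eq_mul]
  ring

lemma psiM_nonneg {M X : Matrix (Fin 3) (Fin 3) ℝ} (hM : M.IsSymm)
    (hG : (M.trace • (1 : Matrix (Fin 3) (Fin 3) ℝ) - M).PosSemidef) (hX : X ∈ SO3) :
    0 ≤ psiM M X := by
  rw [psiM_eq_trace_mul_axisProj hM]
  exact trace_mul_axisProj_nonneg hG hX

lemma psiM_le_two_mul {M X : Matrix (Fin 3) (Fin 3) ℝ} (hM : M.IsSymm) {c : ℝ}
    (hG : (M.trace • (1 : Matrix (Fin 3) (Fin 3) ℝ) - M).PosSemidef)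
    (hc : (c • (1 : Matrix (Fin 3) (Fin 3) ℝ) -
        (M.trace • (1 : Matrix (Fin 3) (Fin 3) ℝ) - M)).PosSemidef) (hX : X ∈ SO3) :
    psiM M X ≤ 2 * c := by
  have hc0 : 0 ≤ c := by
    have h := (hc.add hG).trace_nonneg
    rw [sub_add_cancel, trace_smul, trace_one, Fintype.card_fin, smul_eq_mul] at h
    norm_num at h
    exact h
  have h := trace_mul_axisProj_nonneg hc hX
  rw [sub_mul, trace_sub, ← psiM_eq_trace_mul_axisProj hM, smul_mul_assoc, one_mul, trace_smul,
    trace_axisProj, smul_eq_mul] at h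
  nlinarith [neg_one_le_trace_of_mem_SO3 hX]

lemma posSemidef_iSup_eigenvalues_smul_one_sub {n : Type*} [Fintype n] [DecidableEq n]
    {A : Matrix n n ℝ} (hA : A.IsHermitian) :
    ((⨆ i, hA.eigenvalues i) • (1 : Matrix n n ℝ) - A).PosSemidef := by
  set L := ⨆ i, hA.eigenvalues i
  set U := hA.eigenvectorUnitary
  have hD : (diagonal fun i => L - hA.eigenvalues i).PosSemidef :=
    posSemidef_diagonal_iff.mpr fun i =>
      sub_nonneg.mpr (le_ciSup (Set.finite_range hA.eigenvalues).bddAbove i)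
  have h := hD.mul_mul_conjTranspose_same (U : Matrix n n ℝ)
  have hs := hA.spectral_theorem
  rw [Unitary.conjStarAlgAut_apply] at hs
  have hU : (U : Matrix n n ℝ) * (U : Matrix n n ℝ)ᴴ = 1 := Unitary.coe_mul_star_self U
  have hd : (diagonal fun i => L - hA.eigenvalues i) =
      L • (1 : Matrix n n ℝ) - diagonal (RCLike.ofReal ∘ hA.eigenvalues) := by
    rw [smul_one_eq_diagonal, diagonal_sub]
    rfl
  rw [hd, mul_sub, sub_mul, mul_smul_comm, smul_mul_assoc, mul_one, hU] at h
  convert h using 2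
  exact hs

/-- If G := tr(M)·I − M is positive semidefinite and c·I − G is positive
semidefinite, then 0 ≤ Ψ_M(X) ≤ 2c on SO(3); in particular
Ψ_M(X) ≤ 2·λ_max(G). -/
theorem modified_trace_bounds
    (M : Matrix (Fin 3) (Fin 3) ℝ) (hM : M.IsSymm) (c : ℝ)
    (hG : (M.trace • (1 : Matrix (Fin 3) (Fin 3) ℝ) - M).PosSemidef)
    (hc : (c • (1 : Matrix (Fin 3) (Fin 3) ℝ) -
        (M.trace • (1 : Matrix (Fin 3) (Fin 3) ℝ) - M)).PosSemidef) :
    (∀ X ∈ SO3, 0 ≤ psiM M X ∧ psiM M X ≤ 2 * c) ∧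
    (∀ X ∈ SO3, psiM M X ≤ 2 * ⨆ i, hG.1.eigenvalues i) := by
  exact ⟨fun X hX => ⟨psiM_nonneg hM hG hX, psiM_le_two_mul hM hG hc hX⟩,
    fun X hX => psiM_le_two_mul hM hG (posSemidef_iSup_eigenvalues_smul_one_sub hG.1) hX⟩

end
end

section
/- Let M be a real symmetric 3×3 matrix, u ∈ ℝ³ a unit vector, and θ ∈ ℝ. Then tr(M(I − R_a(θ,u))) = (1 − cos θ)·(tr(M) − uᵀMu); equivalently, Ψ_M(R_a(θ,u)) = (1 − cos θ)·uᵀGu where G := tr(M)·I − M. -/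
open Matrix Real

noncomputable section

/-- The hat map: u^∧ y = u × y. -/
def hat (u : Fin 3 → ℝ) : Matrix (Fin 3) (Fin 3) ℝ :=
  !![0, -u 2, u 1; u 2, 0, -u 0; -u 1, u 0, 0]

/-- The Rodrigues rotation R_a(θ, u) = I + sin θ · u^∧ + (1 − cos θ)·(u^∧)². -/
def Ra (θ : ℝ) (u : Fin 3 → ℝ) : Matrix (Fin 3) (Fin 3) ℝ :=
  1 + Real.sin θ • hat u + (1 - Real.cos θ) • (hat u * hat u)

theorem hat_mul_hat (u : Fin 3 → ℝ) :
    hat u * hat u = vecMulVec u u - (u ⬝ᵥ u) • (1 : Matrix (Fin 3) (Fin 3) ℝ) := by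
  ext i j
  fin_cases i <;> fin_cases j <;>
    simp [hat, Matrix.mul_apply, Fin.sum_univ_three, vecMulVec_apply, dotProduct] <;> ring

theorem transpose_hat (u : Fin 3 → ℝ) : (hat u)ᵀ = -hat u := by
  ext i j
  fin_cases i <;> fin_cases j <;> simp [hat]

theorem trace_mul_hat_of_isSymm {M : Matrix (Fin 3) (Fin 3) ℝ} (hM : M.IsSymm)
    (u : Fin 3 → ℝ) : (M * hat u).trace = 0 := by
  have h : (M * hat u).trace = -(M * hat u).trace := by
    conv_lhs => rw [← trace_transpose, transpose_mul, transpose_hat, hM.eq, trace_mul_comm]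
    simp
  linarith

/-- Evaluation of the modified trace function on a Rodrigues rotation:
Ψ_M(R_a(θ,u)) = (1 − cos θ)·(tr M − uᵀMu) = (1 − cos θ)·uᵀGu. -/
theorem modified_trace_eval_rodrigues
    (M : Matrix (Fin 3) (Fin 3) ℝ) (hM : M.IsSymm)
    (u : Fin 3 → ℝ) (hu : u ⬝ᵥ u = 1) (θ : ℝ) :
    psiM M (Ra θ u) = (1 - Real.cos θ) * (M.trace - u ⬝ᵥ (M *ᵥ u)) ∧
    psiM M (Ra θ u) =
      (1 - Real.cos θ) *
        (u ⬝ᵥ ((M.trace • (1 : Matrix (Fin 3) (Fin 3) ℝ) - M) *ᵥ u)) := by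
  have h : psiM M (Ra θ u) = (1 - Real.cos θ) * (M.trace - u ⬝ᵥ (M *ᵥ u)) := by
    simp only [psiM, Ra, hat_mul_hat, hu, one_smul, mul_sub, mul_add, Matrix.mul_smul, trace_sub,
      trace_add, trace_smul, trace_mul_hat_of_isSymm hM, mul_one, mul_vecMulVec,
      trace_vecMulVec, smul_eq_mul, dotProduct_comm (M *ᵥ u) u]
    ring
  refine ⟨h, h.trans ?_⟩
  rw [sub_mulVec, smul_mulVec, one_mulVec, dotProduct_sub, dotProduct_smul, hu,
    smul_eq_mul, mul_one]

end
end

section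
/- Let (v₁, v₂, v₃) be an orthonormal basis of ℝ³, let λ₁, λ₂, λ₃ ∈ ℝ, and set M := λ₁v₁v₁ᵀ + λ₂v₂v₂ᵀ + λ₃v₃v₃ᵀ. Then for every unit vector u ∈ ℝ³ and every θ ∈ ℝ, tr(M(I − R_a(π,v₁)·R_a(θ,u))) = 2(λ₂ + λ₃) − (1 − cos θ)·[(λ₂ + λ₃) − ⟨u,v₂⟩²(λ₁ + λ₂) − ⟨u,v₃⟩²(λ₁ + λ₃)]. -/
open Matrix Real

noncomputable section

/-- For a unit vector, the square of the hat map is the outer product minus the identity. -/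
theorem hat_mul_hat_of_unit (u : Fin 3 → ℝ) (hu : u ⬝ᵥ u = 1) :
    hat u * hat u = vecMulVec u u - 1 := by
  simp only [dotProduct, Fin.sum_univ_three] at hu
  ext i j
  fin_cases i <;> fin_cases j <;>
    simp [hat, Matrix.mul_apply, Fin.sum_univ_three, vecMulVec_apply] <;> linarith

/-- The rotation by `π` about a unit axis is a reflection through that axis. -/
theorem Ra_pi (v : Fin 3 → ℝ) (hv : v ⬝ᵥ v = 1) :
    Ra π v = (2 : ℝ) • vecMulVec v v - 1 := by
  rw [Ra, hat_mul_hat_of_unit v hv, Real.sin_pi, Real.cos_pi]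
  module

/-- The quadratic form of a Rodrigues rotation. -/
theorem trace_vecMulVec_mul_Ra (u v : Fin 3 → ℝ) (hu : u ⬝ᵥ u = 1) (hv : v ⬝ᵥ v = 1) (θ : ℝ) :
    (vecMulVec v v * Ra θ u).trace = 1 + (1 - Real.cos θ) * ((u ⬝ᵥ v) ^ 2 - 1) := by
  have h_skew : (vecMulVec v v * hat u).trace = 0 := by
    simp [hat, Matrix.trace, Matrix.mul_apply, Fin.sum_univ_three, vecMulVec_apply]
    ring
  simp only [Ra, hat_mul_hat_of_unit u hu, mul_add, mul_sub, mul_one, Matrix.mul_smul, trace_add,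
    trace_smul, trace_sub, h_skew, vecMulVec_mul_vecMulVec, trace_vecMulVec, dotProduct_smul,
    smul_eq_mul, hv, dotProduct_comm v u]
  ring

/-- Parseval's identity for an orthonormal triple in `ℝ³`. -/
theorem sum_sq_dotProduct_of_orthonormal (v₁ v₂ v₃ : Fin 3 → ℝ)
    (h11 : v₁ ⬝ᵥ v₁ = 1) (h22 : v₂ ⬝ᵥ v₂ = 1) (h33 : v₃ ⬝ᵥ v₃ = 1)
    (h12 : v₁ ⬝ᵥ v₂ = 0) (h13 : v₁ ⬝ᵥ v₃ = 0) (h23 : v₂ ⬝ᵥ v₃ = 0) (u : Fin 3 → ℝ) :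
    (u ⬝ᵥ v₁) ^ 2 + (u ⬝ᵥ v₂) ^ 2 + (u ⬝ᵥ v₃) ^ 2 = u ⬝ᵥ u := by
  let V : Matrix (Fin 3) (Fin 3) ℝ := Matrix.of ![v₁, v₂, v₃]
  have hV : V * Vᵀ = 1 := by
    ext i j
    change ![v₁, v₂, v₃] i ⬝ᵥ ![v₁, v₂, v₃] j = _
    fin_cases i <;> fin_cases j <;>
      simp [h11, h22, h33, h12, h13, h23, dotProduct_comm v₂ v₁, dotProduct_comm v₃ v₁,
        dotProduct_comm v₃ v₂]
  have hV' : Vᵀ * V = 1 := mul_eq_one_comm.mp hV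
  have h_norm : (V *ᵥ u) ⬝ᵥ (V *ᵥ u) = u ⬝ᵥ u := by
    rw [dotProduct_mulVec, ← mulVec_transpose, mulVec_mulVec, hV', one_mulVec]
  rw [← h_norm, dotProduct_comm u v₁, dotProduct_comm u v₂, dotProduct_comm u v₃]
  simp [V, dotProduct, mulVec, Fin.sum_univ_three]
  ring

/-- Evaluation of the modified trace function at Rₐ(π,v₁)·Rₐ(θ,u) for
M with orthonormal eigenbasis (v₁,v₂,v₃) and eigenvalues (λ₁,λ₂,λ₃). -/
theorem modified_trace_eval_at_pi_rotation
    (v₁ v₂ v₃ : Fin 3 → ℝ)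
    (h11 : v₁ ⬝ᵥ v₁ = 1) (h22 : v₂ ⬝ᵥ v₂ = 1) (h33 : v₃ ⬝ᵥ v₃ = 1)
    (h12 : v₁ ⬝ᵥ v₂ = 0) (h13 : v₁ ⬝ᵥ v₃ = 0) (h23 : v₂ ⬝ᵥ v₃ = 0)
    (l₁ l₂ l₃ : ℝ) (M : Matrix (Fin 3) (Fin 3) ℝ)
    (hMdef : M = l₁ • vecMulVec v₁ v₁ + l₂ • vecMulVec v₂ v₂ + l₃ • vecMulVec v₃ v₃)
    (u : Fin 3 → ℝ) (hu : u ⬝ᵥ u = 1) (θ : ℝ) :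
    (M * (1 - Ra π v₁ * Ra θ u)).trace =
      2 * (l₂ + l₃) - (1 - Real.cos θ) *
        ((l₂ + l₃) - (u ⬝ᵥ v₂)^2 * (l₁ + l₂) - (u ⬝ᵥ v₃)^2 * (l₁ + l₃)) := by
  have h_reflect : M * Ra π v₁ =
      l₁ • vecMulVec v₁ v₁ - l₂ • vecMulVec v₂ v₂ - l₃ • vecMulVec v₃ v₃ := by
    rw [hMdef, Ra_pi v₁ h11]
    simp only [mul_sub, mul_one, add_mul, Matrix.smul_mul, Matrix.mul_smul,
      vecMulVec_mul_vecMulVec, h11, dotProduct_comm v₂ v₁, dotProduct_comm v₃ v₁, h12, h13,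
      zero_smul, one_smul, vecMulVec_zero, smul_zero]
    module
  have h_parseval := sum_sq_dotProduct_of_orthonormal v₁ v₂ v₃ h11 h22 h33 h12 h13 h23 u
  rw [hu] at h_parseval
  rw [mul_sub, mul_one, ← mul_assoc, h_reflect, hMdef]
  simp only [sub_mul, Matrix.smul_mul, trace_sub, trace_add, trace_smul, trace_vecMulVec,
    trace_vecMulVec_mul_Ra u _ hu h11, trace_vecMulVec_mul_Ra u _ hu h22,
    trace_vecMulVec_mul_Ra u _ hu h33, h11, h22, h33, smul_eq_mul]
  linear_combination (-(1 - Real.cos θ) * l₁) * h_parseval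

end
end

section
/- Let (v₁, v₂, v₃) be an orthonormal basis of ℝ³ and θ ∈ (0, π); write c = cos(θ/2) and s = sin(θ/2). Then the three vectors c(v₂ − v₁) − s·v₃, c(v₃ − v₁) + s·v₂, and −c(v₁ + v₂) + s·v₃ are linearly independent (they span ℝ³). Consequently, for every nonzero x ∈ ℝ³ at least one of these three vectors has nonzero inner product with x. -/
open Matrix Real

noncomputable section

theorem det_warping_coefficients (c s : ℝ) (h : c ^ 2 + s ^ 2 = 1) :
    (!![-c, c, -s; -c, s, c; -c, -c, s] : Matrix (Fin 3) (Fin 3) ℝ).det = -2 * c := by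
  rw [det_fin_three]
  simp
  linear_combination (-2 * c) * h

theorem det_ne_zero_of_orthonormal_rows {v₁ v₂ v₃ : Fin 3 → ℝ}
    (h11 : v₁ ⬝ᵥ v₁ = 1) (h22 : v₂ ⬝ᵥ v₂ = 1) (h33 : v₃ ⬝ᵥ v₃ = 1)
    (h12 : v₁ ⬝ᵥ v₂ = 0) (h13 : v₁ ⬝ᵥ v₃ = 0) (h23 : v₂ ⬝ᵥ v₃ = 0) :
    (Matrix.of ![v₁, v₂, v₃]).det ≠ 0 := by
  have hV : Matrix.of ![v₁, v₂, v₃] * (Matrix.of ![v₁, v₂, v₃])ᵀ = 1 := by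
    ext i j
    change ![v₁, v₂, v₃] i ⬝ᵥ ![v₁, v₂, v₃] j = _
    fin_cases i <;> fin_cases j <;>
      simp [h11, h22, h33, h12, h13, h23, dotProduct_comm v₂ v₁, dotProduct_comm v₃ v₁,
        dotProduct_comm v₃ v₂]
  exact det_ne_zero_of_right_inverse hV

/-- For an orthonormal basis (v₁,v₂,v₃) and θ ∈ (0,π) with c = cos(θ/2),
s = sin(θ/2), the three vectors c(v₂ − v₁) − s·v₃, c(v₃ − v₁) + s·v₂ and
−c(v₁ + v₂) + s·v₃ are linearly independent (they span ℝ³); consequently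
every nonzero x ∈ ℝ³ has nonzero inner product with at least one of them. -/
theorem warping_axes_linear_independent
    (v₁ v₂ v₃ : Fin 3 → ℝ)
    (h11 : v₁ ⬝ᵥ v₁ = 1) (h22 : v₂ ⬝ᵥ v₂ = 1) (h33 : v₃ ⬝ᵥ v₃ = 1)
    (h12 : v₁ ⬝ᵥ v₂ = 0) (h13 : v₁ ⬝ᵥ v₃ = 0) (h23 : v₂ ⬝ᵥ v₃ = 0)
    (θ : ℝ) (hθ : θ ∈ Set.Ioo 0 π)
    (c s : ℝ) (hc : c = Real.cos (θ / 2)) (hs : s = Real.sin (θ / 2))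
    (w₁ w₂ w₃ : Fin 3 → ℝ)
    (hw1 : w₁ = c • (v₂ - v₁) - s • v₃)
    (hw2 : w₂ = c • (v₃ - v₁) + s • v₂)
    (hw3 : w₃ = -(c • (v₁ + v₂)) + s • v₃) :
    LinearIndependent ℝ ![w₁, w₂, w₃] ∧
    Submodule.span ℝ {w₁, w₂, w₃} = (⊤ : Submodule ℝ (Fin 3 → ℝ)) ∧
    ∀ x : Fin 3 → ℝ, x ≠ 0 → (w₁ ⬝ᵥ x ≠ 0 ∨ w₂ ⬝ᵥ x ≠ 0 ∨ w₃ ⬝ᵥ x ≠ 0) := by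
  have hc0 : c ≠ 0 := by
    rw [hc]
    exact (Real.cos_pos_of_mem_Ioo ⟨by linarith [hθ.1, Real.pi_pos], by linarith [hθ.2]⟩).ne'
  have hcs : c ^ 2 + s ^ 2 = 1 := by
    rw [hc, hs, Real.cos_sq_add_sin_sq]
  have hW : Matrix.of ![w₁, w₂, w₃] =
      !![-c, c, -s; -c, s, c; -c, -c, s] * Matrix.of ![v₁, v₂, v₃] := by
    ext i j
    fin_cases i <;> simp [Matrix.mul_apply, Fin.sum_univ_three, hw1, hw2, hw3] <;> ring
  have hdet : (Matrix.of ![w₁, w₂, w₃]).det ≠ 0 := by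
    rw [hW, det_mul, det_warping_coefficients c s hcs]
    exact mul_ne_zero (mul_ne_zero (by norm_num) hc0)
      (det_ne_zero_of_orthonormal_rows h11 h22 h33 h12 h13 h23)
  have hli : LinearIndependent ℝ ![w₁, w₂, w₃] :=
    linearIndependent_rows_of_det_ne_zero hdet
  refine ⟨hli, ?_, fun x hx => ?_⟩
  · have hspan := hli.span_eq_top_of_card_eq_finrank (by simp)
    rwa [range_cons, range_cons, range_cons, range_empty, Set.union_empty] at hspan
  · by_contra! h
    refine hx (eq_zero_of_mulVec_eq_zero hdet ?_)
    ext i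
    change ![w₁, w₂, w₃] i ⬝ᵥ x = 0
    fin_cases i
    exacts [h.1, h.2.1, h.2.2]

end
end

section
/- Let θ ∈ (0, π) and let u_p, u_q ∈ ℝ³ be unit vectors with u_p ≠ u_q. Define c := cos²(θ/2) + ⟨u_p, u_q⟩·sin²(θ/2). Then −1 < c < 1; moreover, setting θ_pq := 2·arccos(c) ∈ (0, 2π) and u_pq := [ (u_p − u_q)·(sin θ)/2 + (u_p × u_q)·sin²(θ/2) ] / sin(θ_pq/2), the vector u_pq is a unit vector and R_a(θ, −u_q) · R_a(θ, u_p) = R_a(θ_pq, u_pq). In particular R_a(θ,−u_q)·R_a(θ,u_p) ≠ I. -/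
open Matrix Real

noncomputable section

/-- The matrix of `y ↦ q y q̄` on imaginary quaternions, for the quaternion `q = w + v`. -/
def quatMatrix (w : ℝ) (v : Fin 3 → ℝ) : Matrix (Fin 3) (Fin 3) ℝ :=
  (w ^ 2 + v ⬝ᵥ v) • (1 : Matrix (Fin 3) (Fin 3) ℝ) + (2 * w) • hat v + (2 : ℝ) • (hat v * hat v)

lemma quatMatrix_mul (a b : ℝ) (u v : Fin 3 → ℝ) :
    quatMatrix a u * quatMatrix b v =
      quatMatrix (a * b - u ⬝ᵥ v) (a • v + b • u + hat u *ᵥ v) := by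
  ext i j
  fin_cases i <;> fin_cases j <;>
    simp [quatMatrix, hat, Matrix.mul_apply, dotProduct, Fin.sum_univ_three,
      Matrix.one_apply] <;>
    ring

lemma quat_normSq_mul (a b : ℝ) (u v : Fin 3 → ℝ) :
    (a * b - u ⬝ᵥ v) ^ 2 +
        (a • v + b • u + hat u *ᵥ v) ⬝ᵥ (a • v + b • u + hat u *ᵥ v) =
      (a ^ 2 + u ⬝ᵥ u) * (b ^ 2 + v ⬝ᵥ v) := by
  simp [hat, dotProduct, Fin.sum_univ_three]
  ring

lemma trace_quatMatrix (w : ℝ) (v : Fin 3 → ℝ) :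
    (quatMatrix w v).trace = 3 * w ^ 2 - v ⬝ᵥ v := by
  simp [quatMatrix, hat, Matrix.trace, dotProduct, Fin.sum_univ_three]
  ring

lemma hat_smul (r : ℝ) (u : Fin 3 → ℝ) : hat (r • u) = r • hat u := by
  ext i j
  fin_cases i <;> fin_cases j <;> simp [hat]

lemma Ra_eq_quatMatrix (θ : ℝ) (u : Fin 3 → ℝ) (hu : u ⬝ᵥ u = 1) :
    Ra θ u = quatMatrix (cos (θ / 2)) (sin (θ / 2) • u) := by
  have hsin : sin θ = 2 * cos (θ / 2) * sin (θ / 2) := by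
    rw [mul_right_comm, ← sin_two_mul, mul_div_cancel₀ θ two_ne_zero]
  have hcos : 1 - cos θ = 2 * (sin (θ / 2) * sin (θ / 2)) := by
    have h := cos_two_mul (θ / 2)
    rw [mul_div_cancel₀ θ two_ne_zero] at h
    linarith [sin_sq_add_cos_sq (θ / 2)]
  have hnorm : cos (θ / 2) ^ 2 + (sin (θ / 2) • u) ⬝ᵥ (sin (θ / 2) • u) = 1 := by
    simp only [smul_dotProduct, dotProduct_smul, hu, smul_eq_mul]
    linarith [sin_sq_add_cos_sq (θ / 2)]
  simp only [Ra, quatMatrix, hnorm, hat_smul, hsin, hcos, one_smul, smul_mul_smul_comm, smul_smul]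

/-- Axis–angle decomposition of R_a(θ,−u_q)·R_a(θ,u_p) for θ ∈ (0,π) and
distinct unit vectors u_p ≠ u_q; in particular this product is not the
identity. -/
theorem rodrigues_composition_axis_angle
    (θ : ℝ) (hθ : θ ∈ Set.Ioo 0 π)
    (up uq : Fin 3 → ℝ) (hup : up ⬝ᵥ up = 1) (huq : uq ⬝ᵥ uq = 1)
    (hne : up ≠ uq)
    (c θpq : ℝ) (upq : Fin 3 → ℝ)
    (hc : c = Real.cos (θ / 2) ^ 2 + (up ⬝ᵥ uq) * Real.sin (θ / 2) ^ 2)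
    (hθpq : θpq = 2 * Real.arccos c)
    (hupq : upq = (Real.sin (θpq / 2))⁻¹ •
        ((Real.sin θ / 2) • (up - uq) + Real.sin (θ / 2) ^ 2 • (hat up *ᵥ uq))) :
    (-1 < c ∧ c < 1) ∧
    θpq ∈ Set.Ioo 0 (2 * π) ∧
    upq ⬝ᵥ upq = 1 ∧
    Ra θ (-uq) * Ra θ up = Ra θpq upq ∧
    Ra θ (-uq) * Ra θ up ≠ 1 := by
  obtain ⟨h0, hπ⟩ := hθ
  have hS : 0 < sin (θ / 2) := sin_pos_of_pos_of_lt_pi (by linarith) (by linarith)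
  have hC : 0 < cos (θ / 2) := cos_pos_of_mem_Ioo ⟨by linarith, by linarith⟩
  have hSC := sin_sq_add_cos_sq (θ / 2)
  have hsub : 0 < (up - uq) ⬝ᵥ (up - uq) :=
    lt_of_le_of_ne (Finset.sum_nonneg fun i _ => mul_self_nonneg _)
      fun h => hne (sub_eq_zero.1 (dotProduct_self_eq_zero.1 h.symm))
  have hadd : 0 ≤ (up + uq) ⬝ᵥ (up + uq) := Finset.sum_nonneg fun i _ => mul_self_nonneg _
  simp only [sub_dotProduct, dotProduct_sub, hup, huq, dotProduct_comm uq up] at hsub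
  simp only [add_dotProduct, dotProduct_add, hup, huq, dotProduct_comm uq up] at hadd
  have hc1 : c < 1 := by rw [hc]; nlinarith [pow_pos hS 2]
  have hc2 : -1 < c := by rw [hc]; nlinarith [pow_pos hS 2, pow_pos hC 2]
  have hhalf : θpq / 2 = arccos c := by rw [hθpq]; ring
  have hcos : cos (θpq / 2) = c := by rw [hhalf, cos_arccos hc2.le hc1.le]
  have hlo : 0 < arccos c := arccos_pos.2 hc1
  have hhi : arccos c < π := by
    refine lt_of_le_of_ne (arccos_le_pi c) fun h => ?_
    linarith [arccos_eq_pi.1 h]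
  have hs : 0 < sin (θpq / 2) := by rw [hhalf]; exact sin_pos_of_pos_of_lt_pi hlo hhi
  have hpq := sin_sq_add_cos_sq (θpq / 2)
  have hunit : (-uq) ⬝ᵥ (-uq) = 1 := by simpa using huq
  have hsin : sin θ = 2 * sin (θ / 2) * cos (θ / 2) := by
    rw [← sin_two_mul, mul_div_cancel₀ θ two_ne_zero]
  have hvec : cos (θ / 2) • (sin (θ / 2) • up) + cos (θ / 2) • (sin (θ / 2) • -uq) +
      hat (sin (θ / 2) • -uq) *ᵥ (sin (θ / 2) • up) = sin (θpq / 2) • upq := by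
    rw [hupq, smul_inv_smul₀ hs.ne', hsin]
    ext i
    fin_cases i <;> simp [hat, dotProduct, Fin.sum_univ_three] <;> ring
  have hscal : cos (θ / 2) * cos (θ / 2) - (sin (θ / 2) • -uq) ⬝ᵥ (sin (θ / 2) • up) =
      cos (θpq / 2) := by
    rw [hcos, hc]
    simp only [smul_dotProduct, dotProduct_smul, neg_dotProduct, smul_eq_mul,
      dotProduct_comm uq up]
    ring
  have hupq1 : upq ⬝ᵥ upq = 1 := by
    have h := quat_normSq_mul (cos (θ / 2)) (cos (θ / 2)) (sin (θ / 2) • -uq) (sin (θ / 2) • up)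
    rw [hvec, hscal] at h
    simp only [smul_dotProduct, dotProduct_smul, hup, hunit, smul_eq_mul, mul_one, ← sq,
      add_comm (cos (θ / 2) ^ 2), hSC, one_pow] at h
    have hs2 := pow_pos hs 2
    refine mul_left_cancel₀ hs2.ne' ?_
    linarith
  have hprod : Ra θ (-uq) * Ra θ up = quatMatrix (cos (θpq / 2)) (sin (θpq / 2) • upq) := by
    rw [Ra_eq_quatMatrix θ _ hunit, Ra_eq_quatMatrix θ _ hup, quatMatrix_mul, hvec, hscal]
  refine ⟨⟨hc2, hc1⟩, ⟨by linarith, by linarith⟩, hupq1,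
    hprod.trans (Ra_eq_quatMatrix θpq upq hupq1).symm, fun h => ?_⟩
  have ht := congrArg Matrix.trace (hprod.symm.trans h)
  simp only [trace_quatMatrix, Matrix.trace_one, Fintype.card_fin, smul_dotProduct,
    dotProduct_smul, hupq1, smul_eq_mul] at ht
  push_cast at ht
  nlinarith [pow_pos hs 2]

end
end

section
/- Let (v₁, v₂, v₃) be an orthonormal basis of ℝ³, let λ > λ₃ > 0, and set M := λ(v₁v₁ᵀ + v₂v₂ᵀ) + λ₃v₃v₃ᵀ. Let the set of warping directions be U := {±v₁, ±v₂}. Then for every u_q ∈ U, every θ ∈ (0, π), and every unit vector v ∈ ℝ³ that is an eigenvector of M, there exists u_p ∈ U with ⟨u_p, u_q⟩ = 0 such that tr(M(I − R_a(π,v)·R_a(θ,−u_q)·R_a(θ,u_p))) < tr(M(I − R_a(π,v))). -/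
open Matrix Real

noncomputable section

/-- The hat map is equivariant under orthogonal matrices up to the sign of the determinant. -/
theorem hat_mulVec {P : Matrix (Fin 3) (Fin 3) ℝ} (hP : P * Pᵀ = 1) (x : Fin 3 → ℝ) :
    hat (P *ᵥ x) = P * hat (P.det • x) * Pᵀ := by
  have key : Pᵀ * hat (P *ᵥ x) * P = hat (P.det • x) := by
    ext i j
    fin_cases i <;> fin_cases j <;>
      simp [hat, Matrix.mul_apply, Fin.sum_univ_three, Matrix.mulVec, dotProduct,
        Matrix.det_fin_three] <;> ring
  rw [← key]
  calc hat (P *ᵥ x) = (P * Pᵀ) * hat (P *ᵥ x) * (P * Pᵀ) := by simp [hP]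
    _ = _ := by simp only [Matrix.mul_assoc]

theorem Ra_mulVec {P : Matrix (Fin 3) (Fin 3) ℝ} (hP : P * Pᵀ = 1) (θ : ℝ) (x : Fin 3 → ℝ) :
    Ra θ (P *ᵥ x) = P * Ra θ (P.det • x) * Pᵀ := by
  have hP' : Pᵀ * P = 1 := mul_eq_one_comm.mp hP
  have hsq (A : Matrix (Fin 3) (Fin 3) ℝ) : P * A * Pᵀ * (P * A * Pᵀ) = P * (A * A) * Pᵀ := by
    calc _ = P * A * (Pᵀ * P) * A * Pᵀ := by simp only [Matrix.mul_assoc]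
      _ = _ := by simp only [hP', Matrix.mul_one, Matrix.mul_assoc]
  simp only [Ra, hat_mulVec hP, hsq, Matrix.mul_add, Matrix.add_mul, Matrix.mul_smul,
    Matrix.smul_mul, Matrix.mul_one, hP]

theorem trace_conj_mul {P : Matrix (Fin 3) (Fin 3) ℝ} (hP : P * Pᵀ = 1)
    (D A B C : Matrix (Fin 3) (Fin 3) ℝ) :
    (P * D * Pᵀ * (1 - (P * A * Pᵀ) * (P * B * Pᵀ) * (P * C * Pᵀ))).trace =
      (D * (1 - A * B * C)).trace := by
  have hP' : Pᵀ * P = 1 := mul_eq_one_comm.mp hP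
  have h : P * D * Pᵀ * (1 - (P * A * Pᵀ) * (P * B * Pᵀ) * (P * C * Pᵀ)) =
      P * (D * (1 - A * B * C)) * Pᵀ := by
    have hc (X : Matrix (Fin 3) (Fin 3) ℝ) : Pᵀ * (P * X) = X := by
      rw [← Matrix.mul_assoc, hP', Matrix.one_mul]
    simp only [Matrix.mul_sub, Matrix.sub_mul, Matrix.mul_assoc, hc, Matrix.mul_one]
  rw [h, Matrix.trace_mul_comm, ← Matrix.mul_assoc, hP', Matrix.one_mul]

/-- The synergy inequality in coordinates adapted to the eigenbasis, `d` being its orientation. -/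
theorem trace_diagonal_lt {lam l₃ d θ μ : ℝ} {x : Fin 3 → ℝ} (hl₃ : 0 < l₃) (hlam : l₃ < lam)
    (hd : d * d = 1) (hθ : θ ∈ Set.Ioo (0 : ℝ) π) (hx : x ⬝ᵥ x = 1)
    (hμ : diagonal ![lam, lam, l₃] *ᵥ x = μ • x) (hsign : x 0 * x 1 ≤ 0) :
    (diagonal ![lam, lam, l₃] *
      (1 - Ra π (d • x) * Ra θ (d • -![0, 1, 0]) * Ra θ (d • ![1, 0, 0]))).trace <
    (diagonal ![lam, lam, l₃] * (1 - Ra π (d • x) * 1 * 1)).trace := by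
  have hs : 0 < sin θ := sin_pos_of_pos_of_lt_pi hθ.1 hθ.2
  have hsc := sin_sq_add_cos_sq θ
  have hc1 : cos θ < 1 := by nlinarith [cos_le_one θ]
  have hx' : x 0 * x 0 + x 1 * x 1 + x 2 * x 2 = 1 := by
    simpa [dotProduct, Fin.sum_univ_three] using hx
  have h0 : lam * x 0 = μ * x 0 := by simpa [mulVec_diagonal] using congrFun hμ 0
  have h1 : lam * x 1 = μ * x 1 := by simpa [mulVec_diagonal] using congrFun hμ 1
  have h2 : l₃ * x 2 = μ * x 2 := by simpa [mulVec_diagonal] using congrFun hμ 2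
  have hcases : (x 0 = 0 ∧ x 1 = 0) ∨ x 2 = 0 := by
    by_cases h : x 2 = 0
    · exact Or.inr h
    · have hm : l₃ = μ := mul_right_cancel₀ h h2
      subst hm
      have hne : lam - l₃ ≠ 0 := by linarith
      exact Or.inl ⟨(mul_eq_zero.mp (by linarith : (lam - l₃) * x 0 = 0)).resolve_left hne,
        (mul_eq_zero.mp (by linarith : (lam - l₃) * x 1 = 0)).resolve_left hne⟩
  have hR : Ra π (d • x) = (2 : ℝ) • vecMulVec x x - 1 := by
    ext i j
    fin_cases i <;> fin_cases j <;>
      simp [Ra, hat, vecMulVec_apply] <;> grind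
  have hQ : Ra θ (d • -![0, 1, 0]) * Ra θ (d • ![1, 0, 0]) =
      !![cos θ, -sin θ ^ 2, -(d * sin θ * cos θ); 0, cos θ, -(d * sin θ);
        d * sin θ, d * sin θ * cos θ, cos θ ^ 2] := by
    ext i j
    fin_cases i <;> fin_cases j <;>
      simp [Ra, hat, Matrix.mul_apply, Fin.sum_univ_three] <;> grind
  rw [Matrix.mul_assoc (Ra π _), hQ, hR]
  simp only [Matrix.trace_fin_three, Matrix.mul_apply, Fin.sum_univ_three, Matrix.diagonal,
    vecMulVec_apply, Matrix.sub_apply, Matrix.smul_apply, Matrix.one_apply]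
  simp
  rcases hcases with ⟨h, h'⟩ | h
  · have h3 : x 2 * x 2 = 1 := by rw [h, h'] at hx'; linarith
    simp [h, h', h3]
    nlinarith [mul_pos hl₃ (sub_pos.mpr hc1), mul_pos (sub_pos.mpr hlam) (sub_pos.mpr hc1)]
  · simp [h]
    have e0 : x 0 * x 0 = 1 - x 1 * x 1 := by rw [h] at hx'; linarith
    have hc2 : cos θ ^ 2 = 1 - sin θ ^ 2 := by linarith
    rw [e0, hc2]
    linarith [mul_pos hl₃ (pow_pos hs 2),
      mul_nonneg (mul_nonneg (hl₃.trans hlam).le (sq_nonneg (sin θ))) (neg_nonneg.mpr hsign)]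

/-- The synergy inequality for an orthonormal basis `p, q, n` with warping directions `p`, `q`. -/
theorem trace_warped_lt {p q n v : Fin 3 → ℝ}
    (hpp : p ⬝ᵥ p = 1) (hqq : q ⬝ᵥ q = 1) (hnn : n ⬝ᵥ n = 1)
    (hpq : p ⬝ᵥ q = 0) (hpn : p ⬝ᵥ n = 0) (hqn : q ⬝ᵥ n = 0)
    {lam l₃ θ μ : ℝ} (hl₃ : 0 < l₃) (hlam : l₃ < lam) (hθ : θ ∈ Set.Ioo (0 : ℝ) π)
    {M : Matrix (Fin 3) (Fin 3) ℝ}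
    (hM : M = lam • (vecMulVec p p + vecMulVec q q) + l₃ • vecMulVec n n)
    (hv : v ⬝ᵥ v = 1) (hμ : M *ᵥ v = μ • v) (hsign : (p ⬝ᵥ v) * (q ⬝ᵥ v) ≤ 0) :
    (M * (1 - Ra π v * Ra θ (-q) * Ra θ p)).trace < (M * (1 - Ra π v)).trace := by
  set P : Matrix (Fin 3) (Fin 3) ℝ := (of ![p, q, n])ᵀ with hPdef
  have hP' : Pᵀ * P = 1 := by
    have hqp : q ⬝ᵥ p = 0 := by rw [dotProduct_comm, hpq]
    have hnp : n ⬝ᵥ p = 0 := by rw [dotProduct_comm, hpn]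
    have hnq : n ⬝ᵥ q = 0 := by rw [dotProduct_comm, hqn]
    ext i j
    change (![p, q, n] i) ⬝ᵥ (![p, q, n] j) = _
    fin_cases i <;> fin_cases j <;> simp [*]
  have hP : P * Pᵀ = 1 := mul_eq_one_comm.mp hP'
  have hdet : P.det * P.det = 1 := by
    simpa only [Matrix.det_mul, Matrix.det_transpose P, Matrix.det_one] using congrArg Matrix.det hP
  have hMP : M = P * diagonal ![lam, lam, l₃] * Pᵀ := by
    rw [hM]
    ext i j
    simp [hPdef, Matrix.mul_apply, Fin.sum_univ_three, vecMulVec_apply, Matrix.diagonal]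
    ring
  have hp : p = P *ᵥ ![1, 0, 0] := by
    ext i; simp [hPdef, Matrix.mulVec, dotProduct, Fin.sum_univ_three]
  have hq : -q = P *ᵥ -![0, 1, 0] := by
    ext i; simp [hPdef, Matrix.mulVec, dotProduct, Fin.sum_univ_three]
  obtain ⟨x, hx⟩ : ∃ x, x = Pᵀ *ᵥ v := ⟨_, rfl⟩
  have hvx : v = P *ᵥ x := by rw [hx, Matrix.mulVec_mulVec, hP, Matrix.one_mulVec]
  have hx0 : x 0 = p ⬝ᵥ v := by rw [hx]; rfl
  have hx1 : x 1 = q ⬝ᵥ v := by rw [hx]; rfl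
  have hxx : x ⬝ᵥ x = 1 := by
    rw [← hv]
    conv_rhs => rw [hvx, Matrix.dotProduct_mulVec, ← Matrix.mulVec_transpose,
      Matrix.mulVec_mulVec, hP', Matrix.one_mulVec]
  have hDx : diagonal ![lam, lam, l₃] *ᵥ x = μ • x := by
    have h := congrArg (Pᵀ *ᵥ ·) hμ
    simp only [Matrix.mulVec_smul] at h
    rw [← hx, hMP, Matrix.mulVec_mulVec, ← Matrix.mul_assoc, ← Matrix.mul_assoc, hP',
      Matrix.one_mul, ← Matrix.mulVec_mulVec, ← hx] at h
    exact h
  have key := trace_diagonal_lt hl₃ hlam hdet hθ hxx hDx (by rwa [hx0, hx1])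
  rw [← trace_conj_mul hP, ← trace_conj_mul hP _ _ 1 1, ← hMP, ← Ra_mulVec hP, ← Ra_mulVec hP,
    ← Ra_mulVec hP, ← hvx, ← hp, ← hq] at key
  simpa [hP] using key

/-- Synergy condition (Theorem 1, case 2): for M with eigenvalues
λ = λ₁ = λ₂ > λ₃ > 0 and warping directions U = {±v₁, ±v₂}, every warped
unwanted critical point admits an orthogonal warping direction strictly
decreasing Ψ_M. -/
theorem synergy_case_repeated_max_eigenvalue
    (v₁ v₂ v₃ : Fin 3 → ℝ)
    (h11 : v₁ ⬝ᵥ v₁ = 1) (h22 : v₂ ⬝ᵥ v₂ = 1) (h33 : v₃ ⬝ᵥ v₃ = 1)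
    (h12 : v₁ ⬝ᵥ v₂ = 0) (h13 : v₁ ⬝ᵥ v₃ = 0) (h23 : v₂ ⬝ᵥ v₃ = 0)
    (lam l₃ : ℝ) (hl₃ : 0 < l₃) (hlam : l₃ < lam)
    (M : Matrix (Fin 3) (Fin 3) ℝ)
    (hMdef : M = lam • (vecMulVec v₁ v₁ + vecMulVec v₂ v₂) + l₃ • vecMulVec v₃ v₃)
    (U : Set (Fin 3 → ℝ)) (hU : U = {v₁, -v₁, v₂, -v₂}) :
    ∀ uq ∈ U, ∀ θ ∈ Set.Ioo (0 : ℝ) π, ∀ v : Fin 3 → ℝ, v ⬝ᵥ v = 1 →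
      (∃ μ : ℝ, M *ᵥ v = μ • v) →
      ∃ up ∈ U, up ⬝ᵥ uq = 0 ∧
        (M * (1 - Ra π v * Ra θ (-uq) * Ra θ up)).trace <
          (M * (1 - Ra π v)).trace := by
  subst hU
  have h21 : v₂ ⬝ᵥ v₁ = 0 := by rw [dotProduct_comm, h12]
  have hM' : M = lam • (vecMulVec v₂ v₂ + vecMulVec v₁ v₁) + l₃ • vecMulVec v₃ v₃ := by
    rw [hMdef, add_comm (vecMulVec v₁ v₁)]
  have choose_sign {U : Set (Fin 3 → ℝ)} {p q : Fin 3 → ℝ} (hp : p ∈ U) (hnp : -p ∈ U)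
      (hpp : p ⬝ᵥ p = 1) (hqq : q ⬝ᵥ q = 1) (hpq : p ⬝ᵥ q = 0) (hpn : p ⬝ᵥ v₃ = 0)
      (hqn : q ⬝ᵥ v₃ = 0)
      (hM : M = lam • (vecMulVec p p + vecMulVec q q) + l₃ • vecMulVec v₃ v₃)
      {θ : ℝ} (hθ : θ ∈ Set.Ioo (0 : ℝ) π) {v : Fin 3 → ℝ} (hv : v ⬝ᵥ v = 1)
      {μ : ℝ} (hμ : M *ᵥ v = μ • v) :
      ∃ up ∈ U, up ⬝ᵥ q = 0 ∧
        (M * (1 - Ra π v * Ra θ (-q) * Ra θ up)).trace < (M * (1 - Ra π v)).trace := by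
    rcases le_total ((p ⬝ᵥ v) * (q ⬝ᵥ v)) 0 with h | h
    · exact ⟨p, hp, hpq,
        trace_warped_lt hpp hqq h33 hpq hpn hqn hl₃ hlam hθ hM hv hμ h⟩
    · refine ⟨-p, hnp, by simp [hpq], trace_warped_lt (n := v₃) (by simpa) hqq h33 (by simpa)
        (by simpa) hqn hl₃ hlam hθ (by simpa only [neg_vecMulVec, vecMulVec_neg, neg_neg]) hv hμ ?_⟩
      rw [neg_dotProduct]
      linarith
  rintro uq (rfl | rfl | rfl | rfl) θ hθ v hv ⟨μ, hμ⟩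
  · exact choose_sign (p := v₂) (by simp) (by simp) h22 h11 h21 h23 h13 hM' hθ hv hμ
  · exact choose_sign (p := v₂) (by simp) (by simp) h22 (by simpa) (by simpa) h23 (by simpa)
      (by simpa only [neg_vecMulVec, vecMulVec_neg, neg_neg]) hθ hv hμ
  · exact choose_sign (p := v₁) (by simp) (by simp) h11 h22 h12 h13 h23 hMdef hθ hv hμ
  · exact choose_sign (p := v₁) (by simp) (by simp) h11 (by simpa) (by simpa) h13 (by simpa)
      (by simpa only [neg_vecMulVec, vecMulVec_neg, neg_neg]) hθ hv hμ

end
end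

section
/- Let ξ ∈ [1/2, 1] and define F : ℝ → ℝ by F(t) := max{ 4(ξ − sin²t), ξ − sin²(t + π/3), ξ − sin²(t − π/3) }. Then F(t) ≥ ξ − 1/4 for all t ∈ ℝ, and F(π/2) = ξ − 1/4; hence min_{t∈ℝ} F(t) = ξ − 1/4. -/
open Real

/-- Proposition 2 of the appendix: for ξ ∈ [1/2, 1],
min over ℝ of F(t) = max{4(ξ − sin²t), ξ − sin²(t + π/3), ξ − sin²(t − π/3)}
equals ξ − 1/4, attained at t = π/2. -/
theorem minimax_of_synergy_margins
    (ξ : ℝ) (hξ : ξ ∈ Set.Icc (1/2 : ℝ) 1)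
    (F : ℝ → ℝ)
    (hF : ∀ t, F t = max (4 * (ξ - Real.sin t ^ 2))
        (max (ξ - Real.sin (t + π/3) ^ 2) (ξ - Real.sin (t - π/3) ^ 2))) :
    (∀ t, ξ - 1/4 ≤ F t) ∧ F (π/2) = ξ - 1/4 ∧
    IsLeast (Set.range F) (ξ - 1/4) := by
  obtain ⟨hξ₁, hξ₂⟩ := hξ
  have lower : ∀ t, ξ - 1/4 ≤ F t := by
    intro t
    rw [hF]
    by_contra! h
    obtain ⟨h₀, h₁, h₂⟩ : _ ∧ _ ∧ _ := by simpa only [max_lt_iff] using h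
    rw [sin_add, cos_pi_div_three, sin_pi_div_three] at h₁
    rw [sin_sub, cos_pi_div_three, sin_pi_div_three] at h₂
    have hr : √3 ^ 2 = (3 : ℝ) := sq_sqrt (by norm_num)
    have hsc := sin_sq_add_cos_sq t
    set s := sin t
    set c := cos t
    have hp : 0 < c ^ 2 + √3 * s * c := by linear_combination 2 * h₁ + hsc / 2 + c ^ 2 / 2 * hr
    have hm : 0 < c ^ 2 - √3 * s * c := by linear_combination 2 * h₂ + hsc / 2 + c ^ 2 / 2 * hr
    have hprod : 0 < c ^ 2 * (c ^ 2 - 3 * s ^ 2) := by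
      linear_combination mul_pos hp hm - s ^ 2 * c ^ 2 * hr
    have hneg : c ^ 2 - 3 * s ^ 2 ≤ 0 := by linarith
    exact absurd hprod (mul_nonpos_of_nonneg_of_nonpos (sq_nonneg c) hneg).not_gt
  have attained : F (π/2) = ξ - 1/4 := by
    have h₁ : sin (π/2 + π/3) = 1/2 := by rw [add_comm, sin_add_pi_div_two, cos_pi_div_three]
    have h₂ : sin (π/2 - π/3) = 1/2 := by rw [sin_pi_div_two_sub, cos_pi_div_three]
    rw [hF, h₁, h₂, sin_pi_div_two, max_self, max_eq_right (by linarith)]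
    norm_num
  refine ⟨lower, attained, ⟨π/2, attained⟩, ?_⟩
  rintro _ ⟨t, rfl⟩
  exact lower t
end

section
/- Let 0 < k < 1/√2, and for α ∈ [0, 1] define s(α) := 2k/(1 + √(1 + 4k²α²)) and γ(α) := α·s(α)·√(1 − s(α)²) + s(α)·√((1 − α²)/2). Then γ(α) > α·γ(1) + (1 − α)·γ(0) for all α ∈ (0, 1); consequently min_{α∈[0,1]} γ(α) = min{γ(0), γ(1)}, where γ(0)² = k²/2 and γ(1)² = Ξ²(1 − Ξ²) with Ξ := 2k/(1 + √(1 + 4k²)). -/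
open Real

/-- On `[0, 1/√2]` the function `x ↦ x √(1 - x²)` is monotone. -/
lemma mul_sqrt_one_sub_sq_le {x y : ℝ} (hx : 0 ≤ x) (hxy : x ≤ y) (hy : y ^ 2 ≤ 1 / 2) :
    x * √(1 - x ^ 2) ≤ y * √(1 - y ^ 2) := by
  have hxy2 : x ^ 2 ≤ y ^ 2 := pow_le_pow_left₀ hx hxy 2
  have hy0 : 0 ≤ y := hx.trans hxy
  refine (sq_le_sq₀ (by positivity) (by positivity)).1 ?_
  rw [mul_pow, mul_pow, sq_sqrt (by linarith), sq_sqrt (by linarith)]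
  nlinarith [mul_nonneg (sub_nonneg.2 hxy2) (by linarith : (0 : ℝ) ≤ 1 - x ^ 2 - y ^ 2)]

/-- For `k² ≤ 1/2`, the self-consistent half-angle dominates `2k / (2 + a²)`. -/
lemma two_mul_div_two_add_sq_le {k a : ℝ} (hk : 0 ≤ k) (hk2 : k ^ 2 ≤ 1 / 2) :
    2 * k / (2 + a ^ 2) ≤ 2 * k / (1 + √(1 + 4 * k ^ 2 * a ^ 2)) := by
  have hR : √(1 + 4 * k ^ 2 * a ^ 2) ≤ 1 + a ^ 2 := by
    refine sqrt_le_iff.2 ⟨by positivity, ?_⟩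
    nlinarith [mul_nonneg (sq_nonneg a) (sub_nonneg.2 hk2), sq_nonneg (a ^ 2)]
  exact div_le_div_of_nonneg_left (by positivity) (by positivity) (by linarith)

lemma one_sub_mul_lt_mul_sqrt {k a t : ℝ} (hk : 0 < k) (ha : 0 < a) (ha1 : a < 1)
    (ht : 2 * k / (2 + a ^ 2) ≤ t) :
    (1 - a) * (k * √(1 / 2)) < t * √((1 - a ^ 2) / 2) := by
  have hlt : (2 + a ^ 2) ^ 2 * (1 - a) < 4 * (1 + a) := by
    have h3 : 0 < a ^ 3 := by positivity
    have h5 : 0 < a ^ 5 := by positivity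
    nlinarith [mul_pos ha (sub_pos.2 ha1), mul_pos h3 (sub_pos.2 ha1)]
  refine lt_of_lt_of_le ?_ (mul_le_mul_of_nonneg_right ht (sqrt_nonneg _))
  have h1a : 0 < 1 - a := sub_pos.2 ha1
  refine (sq_lt_sq₀ (by positivity) (by positivity)).1 ?_
  rw [mul_pow, mul_pow, mul_pow, div_pow, sq_sqrt (by norm_num),
    sq_sqrt (by nlinarith), div_mul_eq_mul_div, lt_div_iff₀ (by positivity)]
  have := mul_lt_mul_of_pos_left hlt (by positivity : 0 < k ^ 2 * (1 - a) / 2)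
  nlinarith

/-- Key analytic step of Theorem 2, case (1): for 0 < k < 1/√2, the function
γ(α) = α·s(α)·√(1 − s(α)²) + s(α)·√((1 − α²)/2), with
s(α) = 2k/(1 + √(1 + 4k²α²)), lies strictly above the chord between its
endpoint values on (0,1); hence its minimum on [0,1] is min{γ(0), γ(1)},
where γ(0)² = k²/2 and γ(1)² = Ξ²(1 − Ξ²) with Ξ = 2k/(1 + √(1 + 4k²)). -/
theorem gamma_strictly_above_chord
    (k : ℝ) (hk : 0 < k) (hk2 : k < 1 / Real.sqrt 2)
    (s γ : ℝ → ℝ) (Ξ : ℝ)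
    (hs : ∀ α, s α = 2 * k / (1 + Real.sqrt (1 + 4 * k^2 * α^2)))
    (hγ : ∀ α, γ α = α * s α * Real.sqrt (1 - (s α)^2) +
        s α * Real.sqrt ((1 - α^2) / 2))
    (hΞ : Ξ = 2 * k / (1 + Real.sqrt (1 + 4 * k^2))) :
    (∀ α ∈ Set.Ioo (0 : ℝ) 1, α * γ 1 + (1 - α) * γ 0 < γ α) ∧
    IsLeast (γ '' Set.Icc 0 1) (min (γ 0) (γ 1)) ∧
    (γ 0)^2 = k^2 / 2 ∧ (γ 1)^2 = Ξ^2 * (1 - Ξ^2) := by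
  have hk2' : k ^ 2 ≤ 1 / 2 := by
    have h := pow_le_pow_left₀ hk.le hk2.le 2
    rwa [div_pow, sq_sqrt (by norm_num), one_pow] at h
  have hs0 : s 0 = k := by
    rw [hs]
    norm_num
  have hs1 : s 1 = Ξ := by
    rw [hs, hΞ]
    norm_num
  have hanti : ∀ {a b : ℝ}, 0 ≤ a → a ≤ b → s b ≤ s a := by
    intro a b ha hab
    rw [hs, hs]
    gcongr
  have hs_pos : ∀ a, 0 < s a := by
    intro a
    rw [hs]
    positivity
  have hs_sq : ∀ {a : ℝ}, 0 ≤ a → s a ^ 2 ≤ 1 / 2 := fun {a} ha =>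
    (pow_le_pow_left₀ (hs_pos a).le (hs0 ▸ hanti le_rfl ha) 2).trans hk2'
  have hγ0 : γ 0 = k * √(1 / 2) := by
    rw [hγ, hs0]
    norm_num
  have hγ1 : γ 1 = s 1 * √(1 - s 1 ^ 2) := by
    rw [hγ]
    norm_num
  have hchord : ∀ α ∈ Set.Ioo (0 : ℝ) 1, α * γ 1 + (1 - α) * γ 0 < γ α := by
    rintro α ⟨hα0, hα1⟩
    rw [hγ0, hγ1, hγ α, mul_assoc α]
    refine add_lt_add_of_le_of_lt (mul_le_mul_of_nonneg_left ?_ hα0.le) ?_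
    · exact mul_sqrt_one_sub_sq_le (hs_pos 1).le (hanti hα0.le hα1.le) (hs_sq hα0.le)
    · exact one_sub_mul_lt_mul_sqrt hk hα0 hα1 (hs α ▸ two_mul_div_two_add_sq_le hk.le hk2')
  refine ⟨hchord, ⟨?_, ?_⟩, ?_, ?_⟩
  · rcases min_choice (γ 0) (γ 1) with h | h <;> rw [h]
    · exact ⟨0, by simp, rfl⟩
    · exact ⟨1, by simp, rfl⟩
  · rintro _ ⟨α, ⟨hα0, hα1⟩, rfl⟩
    rcases hα0.eq_or_lt with rfl | hα0
    · exact min_le_left _ _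
    rcases hα1.eq_or_lt with rfl | hα1
    · exact min_le_right _ _
    refine le_trans ?_ (hchord α ⟨hα0, hα1⟩).le
    have h0 := mul_le_mul_of_nonneg_left (min_le_left (γ 0) (γ 1)) (sub_pos.2 hα1).le
    have h1 := mul_le_mul_of_nonneg_left (min_le_right (γ 0) (γ 1)) hα0.le
    linarith
  · rw [hγ0, mul_pow, sq_sqrt (by norm_num)]
    ring
  · rw [hγ1, mul_pow, sq_sqrt (by linarith [hs_sq zero_le_one]), hs1]
end

section
/- Let ξ ∈ [1/2, 1] and define g : ℝ → ℝ by g(t) := 3ξ − 4·sin²t + sin²(t − π/3) (that is, g = f₁ − f₃ with f₁(t) = 4(ξ − sin²t) and f₃(t) = ξ − sin²(t − π/3)). Then g is strictly decreasing on the interval [0, π/3], g(0) = 3ξ + 3/4 > 0, and g(π/3) = 3ξ − 3 ≤ 0; consequently g has exactly one zero in (0, π/3]. -/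
open Real

theorem strictMonoOn_sin_sq : StrictMonoOn (fun t : ℝ => sin t ^ 2) (Set.Icc 0 (π / 2)) := by
  intro a ha b hb hab
  have hpi := pi_pos
  have hsin : sin a < sin b :=
    strictMonoOn_sin ⟨by linarith [ha.1], ha.2⟩ ⟨by linarith [hb.1], hb.2⟩ hab
  have hnonneg : 0 ≤ sin a := sin_nonneg_of_nonneg_of_le_pi ha.1 (by linarith [ha.2])
  exact pow_lt_pow_left₀ hsin hnonneg two_ne_zero

theorem sin_sq_pi_div_three : sin (π / 3) ^ 2 = 3 / 4 := by
  rw [sin_pi_div_three, div_pow, sq_sqrt (by norm_num)]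
  norm_num

/-- Structural step in the proof of Proposition 2: for ξ ∈ [1/2, 1], the
function g(t) = 3ξ − 4sin²t + sin²(t − π/3) is strictly decreasing on
[0, π/3], with g(0) = 3ξ + 3/4 > 0 and g(π/3) = 3ξ − 3 ≤ 0; consequently g
has exactly one zero in (0, π/3]. -/
theorem g_strictly_decreasing_unique_zero
    (ξ : ℝ) (hξ : ξ ∈ Set.Icc (1/2 : ℝ) 1)
    (g : ℝ → ℝ)
    (hg : ∀ t, g t = 3 * ξ - 4 * Real.sin t ^ 2 + Real.sin (t - π/3) ^ 2) :
    StrictAntiOn g (Set.Icc 0 (π/3)) ∧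
    g 0 = 3 * ξ + 3/4 ∧ 0 < g 0 ∧
    g (π/3) = 3 * ξ - 3 ∧ g (π/3) ≤ 0 ∧
    ∃! t, t ∈ Set.Ioc 0 (π/3) ∧ g t = 0 := by
  have hpi := pi_pos
  have hanti : StrictAntiOn g (Set.Icc 0 (π/3)) := by
    intro a ha b hb hab
    have h₁ : sin a ^ 2 < sin b ^ 2 :=
      strictMonoOn_sin_sq ⟨ha.1, by linarith [ha.2]⟩ ⟨hb.1, by linarith [hb.2]⟩ hab
    have h₂ : sin (π/3 - b) ^ 2 < sin (π/3 - a) ^ 2 :=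
      strictMonoOn_sin_sq ⟨by linarith [hb.2], by linarith [hb.1]⟩
        ⟨by linarith [ha.2], by linarith [ha.1]⟩ (by linarith)
    rw [← neg_sub b, ← neg_sub a, sin_neg, sin_neg, neg_sq, neg_sq] at h₂
    rw [hg, hg]
    linarith
  have hzero : g 0 = 3 * ξ + 3/4 := by
    rw [hg, zero_sub, sin_neg, neg_sq, sin_sq_pi_div_three, sin_zero]
    ring
  have hend : g (π/3) = 3 * ξ - 3 := by
    rw [hg, sub_self, sin_sq_pi_div_three, sin_zero]
    ring
  have hpos : 0 < g 0 := by linarith [hξ.1]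
  have hnonpos : g (π/3) ≤ 0 := by linarith [hξ.2]
  refine ⟨hanti, hzero, hpos, hend, hnonpos, ?_⟩
  have hcont : Continuous g := by
    rw [funext hg]
    fun_prop
  obtain ⟨t, ht, hgt⟩ := intermediate_value_Icc' (by positivity : (0 : ℝ) ≤ π/3)
    hcont.continuousOn ⟨hnonpos, hpos.le⟩
  have hne : t ≠ 0 := by
    rintro rfl
    exact hpos.ne' hgt
  refine ⟨t, ⟨⟨lt_of_le_of_ne ht.1 hne.symm, ht.2⟩, hgt⟩, ?_⟩
  rintro s ⟨hs, hgs⟩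
  exact hanti.injOn (Set.Ioc_subset_Icc_self hs) ht (hgs.trans hgt.symm)
end
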